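/- arXiv:1207.0164 — 2 statements merged into one kernel-verified Lean document; each statement's English description precedes it below -/
import Mathlib

section
/- (Braun's theorem.) Let P, Q ⊂ ℝ^n be lattice polytopes such that P is reflexive, Q contains the origin in its relative interior, and P ⊕ Q is a free sum. Then Ehr_{P⊕Q}(t) = (1 − t)·Ehr_P(t)·Ehr_Q(t) in ℤ[[t]]; equivalently, for every integer k ≥ 0, L_{P⊕Q}(k) = Σ_{i=0}^{k} L_P(i)·L_Q(k−i) − Σ_{i=0}^{k−1} L_P(i)·L_Q(k−1−i). -/
open Set Pointwise
open scoped Classical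

noncomputable section

namespace ArxivFreeSum

/-- A point of `ℝ^m` is an integer lattice point iff all coordinates are integers. -/
def IsLat {m : ℕ} (x : Fin m → ℝ) : Prop := ∀ i, ∃ z : ℤ, x i = (z : ℝ)

/-- The set of integer lattice points of a set `S`. -/
def latt {m : ℕ} (S : Set (Fin m → ℝ)) : Set (Fin m → ℝ) := {x | x ∈ S ∧ IsLat x}

variable {n : ℕ}

/-- The affine embedding `α : ℝ^n → ℝ^{n+1}`, `a ↦ (a, 1)`. -/
def emb (a : Fin n → ℝ) : Fin (n + 1) → ℝ := Fin.snoc a 1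

/-- The cone over `K`: all nonnegative multiples of `α(K)`. -/
def cone (K : Set (Fin n → ℝ)) : Set (Fin (n + 1) → ℝ) :=
  {x | ∃ l : ℝ, ∃ a ∈ K, 0 ≤ l ∧ x = l • emb a}

/-- The last standard basis vector `e_{n+1}` of `ℝ^{n+1}`. -/
def eLast (n : ℕ) : Fin (n + 1) → ℝ := Pi.single (Fin.last n) 1

/-- The vertical projection `ε_J` onto the lower envelope of `cone J`. -/
def eps (J : Set (Fin n → ℝ)) (x : Fin (n + 1) → ℝ) : Fin (n + 1) → ℝ :=
  x - sSup {l : ℝ | x - l • eLast n ∈ cone J} • eLast n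

/-- The lower envelope of `cone J`. -/
def lenv (J : Set (Fin n → ℝ)) : Set (Fin (n + 1) → ℝ) := eps J '' cone J

/-- The lower lattice envelope of `cone J`. -/
def llenv (J : Set (Fin n → ℝ)) : Set (Fin (n + 1) → ℝ) := eps J '' latt (cone J)

/-- `J ⊕ K` is a free sum. -/
def IsFreeSum (J K : Set (Fin n → ℝ)) : Prop :=
  (0 : Fin n → ℝ) ∈ J ∧ (0 : Fin n → ℝ) ∈ K ∧
    ∀ m : Fin n → ℝ, m ∈ Submodule.span ℝ (J ∪ K) → IsLat m →
      ∃! q : (Fin n → ℝ) × (Fin n → ℝ),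
        (q.1 ∈ Submodule.span ℝ J ∧ IsLat q.1) ∧
        (q.2 ∈ Submodule.span ℝ K ∧ IsLat q.2) ∧ m = q.1 + q.2

/-- `N_{J,K}(m)`: the number of pairs of lattice points of `cone J` and `cone K` summing
to `m`. -/
def Npairs (J K : Set (Fin n → ℝ)) (m : Fin (n + 1) → ℤ) : ℕ :=
  Set.ncard {q : (Fin (n + 1) → ℝ) × (Fin (n + 1) → ℝ) |
    q.1 ∈ latt (cone J) ∧ q.2 ∈ latt (cone K) ∧ q.1 + q.2 = fun i => (m i : ℝ)}

/-- The coefficientwise form of the multivariate Braun equation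
`σ_{cone(J⊕K)} = (1 - z_{n+1}) σ_{cone J} σ_{cone K}`. -/
def BraunEq (J K : Set (Fin n → ℝ)) : Prop :=
  ∀ m : Fin (n + 1) → ℤ,
    (Npairs J K m : ℤ) - (Npairs J K (m - Pi.single (Fin.last n) 1) : ℤ) =
      if (fun i => (m i : ℝ)) ∈ cone (convexHull ℝ (J ∪ K)) then 1 else 0

/-- A rational polytope: convex hull of finitely many rational points. -/
def IsRatPolytope (P : Set (Fin n → ℝ)) : Prop :=
  ∃ V : Finset (Fin n → ℝ), (∀ v ∈ V, ∀ i, ∃ q : ℚ, v i = (q : ℝ)) ∧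
    P = convexHull ℝ (V : Set (Fin n → ℝ))

/-- A lattice polytope: convex hull of finitely many lattice points. -/
def IsLatPolytope (P : Set (Fin n → ℝ)) : Prop :=
  ∃ V : Finset (Fin n → ℝ), (∀ v ∈ V, IsLat v) ∧ P = convexHull ℝ (V : Set (Fin n → ℝ))

/-- The polar dual `P^∨ ⊆ (lin P)^*` of a polytope `P` containing the origin. -/
def dualSet (P : Set (Fin n → ℝ)) : Set (Module.Dual ℝ (Submodule.span ℝ P)) :=
  {φ | ∀ a : Submodule.span ℝ P, (a : Fin n → ℝ) ∈ P → φ a ≤ 1}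

/-- Membership in the dual integer lattice `(lin P)^*_ℤ`. -/
def IsDualLatticePt (P : Set (Fin n → ℝ)) (φ : Module.Dual ℝ (Submodule.span ℝ P)) : Prop :=
  ∀ a : Submodule.span ℝ P, IsLat (a : Fin n → ℝ) → ∃ z : ℤ, φ a = (z : ℝ)

/-- `P^∨` is a lattice polyhedron: every vertex (= extreme point) of `P^∨` lies in the
dual integer lattice. -/
def DualIsLatticePolyhedron (P : Set (Fin n → ℝ)) : Prop :=
  ∀ φ ∈ Set.extremePoints ℝ (dualSet P), IsDualLatticePt P φ

/-- `den(P^∨)`: the smallest positive integer `d` such that `d • P^∨` is a lattice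
polyhedron. -/
def dualDen (P : Set (Fin n → ℝ)) : ℕ :=
  sInf {d : ℕ | 0 < d ∧ ∀ φ ∈ Set.extremePoints ℝ (dualSet P), IsDualLatticePt P ((d : ℝ) • φ)}

/-- `L_P(k)`, with `L_P(0) = 1`. -/
def ehr (P : Set (Fin n → ℝ)) (k : ℕ) : ℕ :=
  if k = 0 then 1 else Set.ncard (latt ((k : ℝ) • P))

/-- The coefficientwise form of `Ehr_{P⊕Q}(t) = (1-t) Ehr_P(t) Ehr_Q(t)`. -/
def EhrEq (P Q : Set (Fin n → ℝ)) : Prop :=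
  ∀ k : ℕ,
    (ehr (convexHull ℝ (P ∪ Q)) k : ℤ) =
      (∑ i ∈ Finset.range (k + 1), (ehr P i : ℤ) * (ehr Q (k - i) : ℤ)) -
        ∑ i ∈ Finset.range k, (ehr P i : ℤ) * (ehr Q (k - 1 - i) : ℤ)

/-- `P` is reflexive: a lattice polytope containing the origin in its relative interior
whose polar dual is a lattice polytope. -/
def IsReflexive (P : Set (Fin n → ℝ)) : Prop :=
  IsLatPolytope P ∧ (0 : Fin n → ℝ) ∈ intrinsicInterior ℝ P ∧ DualIsLatticePolyhedron P

/-- `P` is Gorenstein of index `k`. -/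
def IsGorenstein (P : Set (Fin n → ℝ)) (k : ℕ) : Prop :=
  IsLatPolytope P ∧ 0 < k ∧
    ∃ m : Fin n → ℝ, IsLat m ∧ IsReflexive ((fun x => x - m) '' ((k : ℝ) • P))

/-- `p` is a rational point. -/
def IsRatPt (p : Fin n → ℝ) : Prop := ∀ i, ∃ q : ℚ, p i = (q : ℝ)

/-- Membership in the lattice `Λ^p` generated by `e_1, …, e_n` and `p`. -/
def InLambda (p x : Fin n → ℝ) : Prop :=
  ∃ (z : Fin n → ℤ) (c : ℤ), x = (fun i => (z i : ℝ)) + (c : ℝ) • p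

/-- `den(p)`: the lcm of the denominators of the coordinates of `p`, i.e. the least
positive integer `r` with `r • p` a lattice point. -/
def denPt (p : Fin n → ℝ) : ℕ := sInf {r : ℕ | 0 < r ∧ IsLat ((r : ℝ) • p)}

/-- The projection `ε^p_J` parallel to `α(p)` onto the `p`-lower envelope of `cone J`. -/
def epsP (p : Fin n → ℝ) (J : Set (Fin n → ℝ)) (x : Fin (n + 1) → ℝ) : Fin (n + 1) → ℝ :=
  x - sSup {l : ℝ | x - l • emb p ∈ cone J} • emb p

/-- The `p`-lower envelope of `cone J`. -/
def plenv (p : Fin n → ℝ) (J : Set (Fin n → ℝ)) : Set (Fin (n + 1) → ℝ) := epsP p J '' cone J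

/-- The `p`-lower lattice envelope of `cone J`. -/
def pllenv (p : Fin n → ℝ) (J : Set (Fin n → ℝ)) : Set (Fin (n + 1) → ℝ) :=
  epsP p J '' latt (cone J)

/-- `J ⊕ K` is an affine free sum with common (rational) point `p`. -/
def IsAffineFreeSum (J K : Set (Fin n → ℝ)) (p : Fin n → ℝ) : Prop :=
  IsRatPt p ∧ p ∈ J ∧ p ∈ K ∧
    ((affineSpan ℝ J : Set (Fin n → ℝ)) ∩ (affineSpan ℝ K : Set (Fin n → ℝ)) = {p}) ∧
    ∀ m : Fin n → ℝ, m ∈ Submodule.span ℝ ((fun x => x - p) '' (J ∪ K)) → InLambda p m →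
      ∃! q : (Fin n → ℝ) × (Fin n → ℝ),
        (q.1 ∈ Submodule.span ℝ ((fun x => x - p) '' J) ∧ InLambda p q.1) ∧
        (q.2 ∈ Submodule.span ℝ ((fun x => x - p) '' K) ∧ InLambda p q.2) ∧ m = q.1 + q.2


lemma lat_zero {m : ℕ} : IsLat (0 : Fin m → ℝ) := fun _ => ⟨0, by simp⟩

lemma lat_add {m : ℕ} {x y : Fin m → ℝ} (hx : IsLat x) (hy : IsLat y) : IsLat (x + y) := by
  intro i
  obtain ⟨a, ha⟩ := hx i
  obtain ⟨b, hb⟩ := hy i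
  exact ⟨a + b, by simp [ha, hb]⟩

lemma lat_neg {m : ℕ} {x : Fin m → ℝ} (hx : IsLat x) : IsLat (-x) := by
  intro i
  obtain ⟨a, ha⟩ := hx i
  exact ⟨-a, by simp [ha]⟩

lemma latPoly_span {P : Set (Fin n → ℝ)} (hP : IsLatPolytope P) :
    ∃ V : Set (Fin n → ℝ), (∀ v ∈ V, IsLat v) ∧ Submodule.span ℝ P = Submodule.span ℝ V := by
  obtain ⟨V, hV, rfl⟩ := hP
  refine ⟨V, hV, le_antisymm ?_ ?_⟩
  · rw [Submodule.span_le]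
    exact convexHull_min Submodule.subset_span (Submodule.convex _)
  · exact Submodule.span_mono (subset_convexHull ℝ _)

/-- Applying a rational functional coordinatewise preserves spans of lattice vectors. -/
lemma span_map (f : ℝ →ₗ[ℚ] ℚ) {V : Set (Fin n → ℝ)} (hV : ∀ v ∈ V, IsLat v)
    {x : Fin n → ℝ} (hx : x ∈ Submodule.span ℝ V) :
    (fun i => (f (x i) : ℝ)) ∈ Submodule.span ℝ V := by
  have key : ∀ c : ℝ, (fun i => (f (c * x i) : ℝ)) ∈ Submodule.span ℝ V := by
    induction hx using Submodule.span_induction with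
    | mem v hv =>
      intro c
      have : (fun i => (f (c * v i) : ℝ)) = (f c : ℝ) • v := by
        funext i
        obtain ⟨z, hz⟩ := hV v hv i
        have h1 : f (c * v i) = (z : ℚ) * f c := by
          rw [hz]
          have : c * (z : ℝ) = (z : ℚ) • c := by
            rw [Rat.smul_def]; push_cast; ring
          rw [this, map_smul, smul_eq_mul]
        rw [h1]
        simp [hz, mul_comm]
      rw [this]
      exact Submodule.smul_mem _ _ (Submodule.subset_span hv)
    | zero => 
      intro c
      have : (fun i => (f (c * (0 : Fin n → ℝ) i) : ℝ)) = 0 := by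
        funext i; simp
      rw [this]; exact Submodule.zero_mem _
    | add x y _ _ hx hy =>
      intro c
      have : (fun i => (f (c * (x + y) i) : ℝ)) =
          (fun i => (f (c * x i) : ℝ)) + (fun i => (f (c * y i) : ℝ)) := by
        funext i; simp [mul_add]
      rw [this]; exact Submodule.add_mem _ (hx c) (hy c)
    | smul a x _ hx =>
      intro c
      have := hx (c * a)
      simpa [mul_assoc] using this
  simpa using key 1

lemma rat_scale (y : Fin n → ℚ) :
    ∃ d : ℕ, 0 < d ∧ IsLat ((d : ℝ) • fun i => (y i : ℝ)) := by
  refine ⟨∏ i, (y i).den, Finset.prod_pos fun i _ => (y i).den_pos, fun i => ?_⟩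
  refine ⟨(∏ j ∈ Finset.univ.erase i, ((y j).den : ℤ)) * (y i).num, ?_⟩
  have h := Finset.prod_erase_mul Finset.univ (fun j => (y j).den) (Finset.mem_univ i)
  have h2 : ((y i).den : ℝ) * (y i : ℝ) = (y i).num := by
    have : ((y i).den : ℚ) * y i = (y i).num := by
      rw [mul_comm]; exact Rat.mul_den_eq_num _
    exact_mod_cast this
  simp only [Pi.smul_apply, smul_eq_mul]
  rw [← h]
  push_cast
  rw [mul_assoc, h2]

lemma span_disj {P Q : Set (Fin n → ℝ)} (hP : IsLatPolytope P) (hQ : IsLatPolytope Q)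
    (hfree : IsFreeSum P Q) {u : Fin n → ℝ} (hu1 : u ∈ Submodule.span ℝ P)
    (hu2 : u ∈ Submodule.span ℝ Q) : u = 0 := by
  obtain ⟨V, hV, hPV⟩ := latPoly_span hP
  obtain ⟨W, hW, hQW⟩ := latPoly_span hQ
  by_contra hne
  obtain ⟨i, hi⟩ := Function.ne_iff.mp hne
  obtain ⟨f, hf⟩ : ∃ f : ℝ →ₗ[ℚ] ℚ, f (u i) ≠ 0 := by
    by_contra hcon
    push Not at hcon
    exact hi ((Module.forall_dual_apply_eq_zero_iff ℚ (u i)).1 hcon)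
  obtain ⟨d, hd, hl⟩ := rat_scale (fun i => f (u i))
  set y : Fin n → ℝ := (d : ℝ) • fun i => (f (u i) : ℝ) with hy
  have hyP : y ∈ Submodule.span ℝ P := by
    rw [hPV] at hu1 ⊢
    exact Submodule.smul_mem _ _ (span_map f hV hu1)
  have hyQ : y ∈ Submodule.span ℝ Q := by
    rw [hQW] at hu2 ⊢
    exact Submodule.smul_mem _ _ (span_map f hW hu2)
  have huniq := (hfree.2.2 0 (Submodule.zero_mem _) lat_zero).unique
    (y₁ := (0, 0)) (y₂ := (y, -y))
    ⟨⟨Submodule.zero_mem _, lat_zero⟩, ⟨Submodule.zero_mem _, lat_zero⟩, by simp⟩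
    ⟨⟨hyP, hl⟩, ⟨Submodule.neg_mem _ hyQ, lat_neg hl⟩, by simp⟩
  have hy0 : y = 0 := (congrArg Prod.fst huniq).symm
  have := congrFun hy0 i
  simp only [hy, Pi.smul_apply, smul_eq_mul, Pi.zero_apply, mul_eq_zero, Nat.cast_eq_zero,
    Rat.cast_eq_zero] at this
  rcases this with h | h
  · omega
  · exact hf h

lemma cpt {P : Set (Fin n → ℝ)} (hP : IsLatPolytope P) : IsCompact P := by
  obtain ⟨V, hV, rfl⟩ := hP
  exact V.finite_toSet.isCompact_convexHull ℝ

lemma cvx {P : Set (Fin n → ℝ)} (hP : IsLatPolytope P) : Convex ℝ P := by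
  obtain ⟨V, hV, rfl⟩ := hP
  exact convex_convexHull ℝ _

lemma latt_finite {S : Set (Fin n → ℝ)} (hS : Bornology.IsBounded S) : (latt S).Finite := by
  obtain ⟨R, hR⟩ := hS.exists_norm_le
  have hfin : (Set.pi Set.univ fun _ : Fin n => Set.Icc (-⌈R⌉) ⌈R⌉).Finite :=
    Set.Finite.pi fun _ => Set.finite_Icc _ _
  refine (hfin.image fun z : Fin n → ℤ => fun i => (z i : ℝ)).subset ?_
  rintro x ⟨hx, hl⟩
  choose z hz using hl
  refine ⟨z, ?_, by funext i; simp [hz]⟩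
  intro i _
  have h1 := (norm_le_pi_norm x i).trans (hR x hx)
  rw [Real.norm_eq_abs, abs_le, hz] at h1
  have h2 := Int.le_ceil R
  constructor
  · have : ((-⌈R⌉ : ℤ) : ℝ) ≤ z i := by push_cast; linarith
    exact_mod_cast this
  · have : (z i : ℝ) ≤ (⌈R⌉ : ℤ) := by linarith
    exact_mod_cast this

lemma smul_mono {P : Set (Fin n → ℝ)} (hc : Convex ℝ P) (h0 : (0 : Fin n → ℝ) ∈ P)
    {r s : ℝ} (hr : 0 ≤ r) (hrs : r ≤ s) : r • P ⊆ s • P := by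
  rintro _ ⟨a, ha, rfl⟩
  rcases hr.eq_or_lt with rfl | hr'
  · exact ⟨0, h0, by simp⟩
  have hs : 0 < s := hr'.trans_le hrs
  refine ⟨(r / s) • a, hc.smul_mem_of_zero_mem h0 ha ⟨by positivity, (div_le_one hs).2 hrs⟩, ?_⟩
  simp only [smul_smul]
  rw [mul_div_cancel₀ _ hs.ne']

lemma smul_sub_span {P : Set (Fin n → ℝ)} {r : ℝ} {x : Fin n → ℝ} (hx : x ∈ r • P) :
    x ∈ Submodule.span ℝ P := by
  obtain ⟨a, ha, rfl⟩ := hx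
  exact Submodule.smul_mem _ _ (Submodule.subset_span ha)

lemma ehr_eq {P : Set (Fin n → ℝ)} (h0 : (0 : Fin n → ℝ) ∈ P) (k : ℕ) :
    ehr P k = (latt ((k : ℝ) • P)).ncard := by
  unfold ehr
  split_ifs with h
  · subst h
    have : latt (((0 : ℕ) : ℝ) • P) = {0} := by
      ext x
      constructor
      · rintro ⟨⟨a, _, rfl⟩, _⟩
        simp
      · rintro rfl
        exact ⟨⟨0, h0, by simp⟩, lat_zero⟩
    rw [this, Set.ncard_singleton]
  · rfl

lemma ball_in {P : Set (Fin n → ℝ)} (h : (0 : Fin n → ℝ) ∈ intrinsicInterior ℝ P) :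
    ∃ δ > 0, ∀ x ∈ Submodule.span ℝ P, ‖x‖ < δ → x ∈ P := by
  have h0 : (0 : Fin n → ℝ) ∈ P := intrinsicInterior_subset h
  obtain ⟨y, hy, hy0⟩ := mem_intrinsicInterior.1 h
  rw [mem_interior_iff_mem_nhds, Metric.mem_nhds_iff] at hy
  obtain ⟨δ, hδ, hb⟩ := hy
  refine ⟨δ, hδ, fun x hx hn => ?_⟩
  have hxa : x ∈ affineSpan ℝ P := by
    have : (vectorSpan ℝ P) = Submodule.span ℝ P := by
      rw [vectorSpan_eq_span_vsub_set_right ℝ h0]; simp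
    have h1 := AffineSubspace.vadd_mem_of_mem_direction
      (s := affineSpan ℝ P) (v := x) (p := 0)
      (by rw [direction_affineSpan, this]; exact hx) (subset_affineSpan ℝ P h0)
    simpa using h1
  have : (⟨x, hxa⟩ : affineSpan ℝ P) ∈ Metric.ball y δ := by
    rw [Metric.mem_ball, Subtype.dist_eq, hy0]
    simpa using hn
  exact hb this

/-- A functional on the span attains its maximum over the polar dual at an extreme point. -/
lemma dual_max_aux {E : Type} [NormedAddCommGroup E] [NormedSpace ℝ E] [FiniteDimensional ℝ E]
    (P : Set E) (δ : ℝ) (hδ : 0 < δ) (hb : ∀ x : E, ‖x‖ < δ → x ∈ P) (p : E)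
    (U : Set (E →ₗ[ℝ] ℝ)) (hU : U = {φ | ∀ a : E, a ∈ P → φ a ≤ 1}) :
    ∃ φ ∈ Set.extremePoints ℝ U, ∀ ψ ∈ U, ψ p ≤ φ p := by
  let T : (E →ₗ[ℝ] ℝ) ≃ₗ[ℝ] (E →L[ℝ] ℝ) := LinearMap.toContinuousLinearMap
  let S : Set (E →L[ℝ] ℝ) := T '' U
  have hS : S = {φ | ∀ a : E, a ∈ P → φ a ≤ 1} := by
    ext φ
    constructor
    · rintro ⟨ψ, hψ, rfl⟩
      rw [hU] at hψ
      exact hψ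
    · intro hφ
      exact ⟨φ.toLinearMap, by rw [hU]; exact hφ, by ext; rfl⟩
  have hclosed : IsClosed S := by
    rw [hS]
    simp only [Set.ofPred_forall]
    refine isClosed_iInter fun a => isClosed_iInter fun _ => ?_
    exact isClosed_le (by fun_prop) continuous_const
  have hbdd : Bornology.IsBounded S := by
    rw [isBounded_iff_forall_norm_le]
    refine ⟨2 / δ, fun φ hφ => ?_⟩
    rw [hS] at hφ
    refine ContinuousLinearMap.opNorm_le_bound _ (by positivity) fun x => ?_
    have key : ∀ x : E, φ x ≤ 2 / δ * ‖x‖ := by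
      intro x
      rcases eq_or_ne x 0 with rfl | hx
      · simp
      have hx' : 0 < ‖x‖ := norm_pos_iff.2 hx
      have h1 : ((δ / (2 * ‖x‖)) • x : E) ∈ P := by
        refine hb _ ?_
        rw [norm_smul, Real.norm_of_nonneg (by positivity)]
        have : δ / (2 * ‖x‖) * ‖x‖ = δ / 2 := by field_simp
        rw [this]; linarith
      have h2 := hφ _ h1
      rw [map_smul, smul_eq_mul, div_mul_eq_mul_div, div_le_one (by positivity)] at h2
      rw [div_mul_eq_mul_div, le_div_iff₀ hδ]
      linarith
    rw [Real.norm_eq_abs, abs_le]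
    have h1 := key x
    have h2 := key (-x)
    rw [map_neg, norm_neg] at h2
    constructor <;> linarith
  haveI : ProperSpace (E →L[ℝ] ℝ) := FiniteDimensional.proper ℝ _
  have hcomp : IsCompact S := Metric.isCompact_of_isClosed_isBounded hclosed hbdd
  have hne : S.Nonempty := ⟨0, by rw [hS]; intro a _; simp⟩
  let ev : (E →L[ℝ] ℝ) →L[ℝ] ℝ := ContinuousLinearMap.apply ℝ ℝ p
  have hexp : IsExposed ℝ S (ev.toExposed S) := ContinuousLinearMap.toExposed.isExposed
  have hne2 : (ev.toExposed S).Nonempty := by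
    obtain ⟨φ, hφ, hmax⟩ := hcomp.exists_isMaxOn hne ev.continuous.continuousOn
    exact ⟨φ, hφ, fun ψ hψ => hmax hψ⟩
  obtain ⟨φ, hφ⟩ := (hexp.isCompact hcomp).extremePoints_nonempty hne2
  have hφS : φ ∈ S.extremePoints ℝ := hexp.isExtreme.extremePoints_subset_extremePoints hφ
  have hmax := (extremePoints_subset hφ).2
  have : S.extremePoints ℝ = T '' (U).extremePoints ℝ := (image_extremePoints T _).symm
  rw [this] at hφS
  obtain ⟨φ', hφ', rfl⟩ := hφS
  exact ⟨φ', hφ', fun ψ hψ => hmax (T ψ) ⟨ψ, hψ, rfl⟩⟩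

lemma dual_max {P : Set (Fin n → ℝ)} (h : (0 : Fin n → ℝ) ∈ intrinsicInterior ℝ P)
    (p : Submodule.span ℝ P) :
    ∃ φ ∈ Set.extremePoints ℝ (dualSet P), ∀ ψ ∈ dualSet P, ψ p ≤ φ p := by
  obtain ⟨δ, hδ, hb⟩ := ball_in h
  exact dual_max_aux {a : Submodule.span ℝ P | (a : Fin n → ℝ) ∈ P} δ hδ
    (fun x hx => hb x x.2 hx) p (dualSet P) rfl

lemma bipolar {P : Set (Fin n → ℝ)} (hc : Convex ℝ P) (hk : IsCompact P)
    (h0 : (0 : Fin n → ℝ) ∈ P) (N : ℕ) (p : Submodule.span ℝ P)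
    (hp : (p : Fin n → ℝ) ∉ (N : ℝ) • P) : ∃ φ ∈ dualSet P, (N : ℝ) < φ p := by
  obtain ⟨f, u, hfu, hup⟩ := geometric_hahn_banach_closed_point (hc.smul (N : ℝ))
    (hk.smul (N : ℝ)).isClosed hp
  have hu : 0 < u := by
    have := hfu 0 ⟨0, h0, by simp⟩
    simpa using this
  rcases Nat.eq_zero_or_pos N with rfl | hN
  · obtain ⟨C, hC⟩ := (hk.image f.continuous).isBounded.exists_norm_le
    have hC0 : 0 < |C| + 1 := by positivity
    refine ⟨(|C| + 1)⁻¹ • (f.toLinearMap.comp (Submodule.span ℝ P).subtype), fun a ha => ?_, ?_⟩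
    · have := (le_abs_self _).trans (hC (f a) ⟨a, ha, rfl⟩)
      simp only [LinearMap.smul_apply, smul_eq_mul]
      rw [inv_mul_le_iff₀ hC0]
      have h3 := le_abs_self C
      change f a ≤ _
      linarith
    · simp only [LinearMap.smul_apply, smul_eq_mul, Nat.cast_zero]
      have : 0 < f p := hu.trans hup
      exact mul_pos (by positivity) this
  · have hN' : (0 : ℝ) < N := by exact_mod_cast hN
    refine ⟨((N : ℝ) / u) • (f.toLinearMap.comp (Submodule.span ℝ P).subtype), fun a ha => ?_, ?_⟩
    · have := hfu ((N : ℝ) • a) ⟨a, ha, rfl⟩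
      rw [map_smul, smul_eq_mul] at this
      simp only [LinearMap.smul_apply, smul_eq_mul]
      change (N : ℝ) / u * f a ≤ 1
      rw [div_mul_eq_mul_div, div_le_one hu]
      exact this.le
    · simp only [LinearMap.smul_apply, smul_eq_mul]
      change (N : ℝ) < (N : ℝ) / u * f p
      rw [div_mul_eq_mul_div, lt_div_iff₀ hu]
      exact mul_lt_mul_of_pos_left hup hN'

lemma integrality {P : Set (Fin n → ℝ)} (hP : IsReflexive P) {r : ℝ} (hr : 0 ≤ r)
    {p : Fin n → ℝ} (hp : p ∈ r • P) (hl : IsLat p) : p ∈ ((⌊r⌋₊ : ℕ) : ℝ) • P := by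
  obtain ⟨hpoly, h0, hd⟩ := hP
  by_contra hcon
  let p' : Submodule.span ℝ P := ⟨p, smul_sub_span hp⟩
  obtain ⟨ψ, hψ, hlt⟩ := bipolar (cvx hpoly) (cpt hpoly) (intrinsicInterior_subset h0) _ p' hcon
  obtain ⟨φ, hφ, hmax⟩ := dual_max h0 p'
  obtain ⟨z, hz⟩ := hd φ hφ p' hl
  have h1 := hlt.trans_le (hmax ψ hψ)
  have h2 : φ p' ≤ r := by
    obtain ⟨a, ha, hap⟩ := hp
    have : p' = r • (⟨a, Submodule.subset_span ha⟩ : Submodule.span ℝ P) :=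
      Subtype.ext hap.symm
    rw [this, map_smul, smul_eq_mul]
    have := (extremePoints_subset hφ) ⟨a, Submodule.subset_span ha⟩ ha
    nlinarith
  rw [hz] at h1 h2
  have h3 : ((⌊r⌋₊ : ℕ) : ℤ) < z := by exact_mod_cast h1
  have h4 : ((⌊r⌋₊ : ℕ) : ℝ) + 1 ≤ z := by exact_mod_cast h3
  have h5 := Nat.lt_floor_add_one r
  linarith

lemma mem_sum {P Q : Set (Fin n → ℝ)} (hcP : Convex ℝ P) (hcQ : Convex ℝ Q)
    (hP0 : (0 : Fin n → ℝ) ∈ P) (hQ0 : (0 : Fin n → ℝ) ∈ Q) (k : ℕ) (m : Fin n → ℝ) :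
    m ∈ (k : ℝ) • convexHull ℝ (P ∪ Q) ↔
      ∃ r s : ℝ, 0 ≤ r ∧ 0 ≤ s ∧ r + s = k ∧ ∃ x ∈ r • P, ∃ y ∈ s • Q, m = x + y := by
  rw [hcP.convexHull_union hcQ ⟨0, hP0⟩ ⟨0, hQ0⟩]
  constructor
  · rintro ⟨w, hw, rfl⟩
    simp only [mem_convexJoin, segment, Set.mem_ofPred_eq] at hw
    obtain ⟨a, ha, b, hb, s, t, hs, ht, hst, rfl⟩ := hw
    refine ⟨k * s, k * t, by positivity, by positivity, by rw [← mul_add, hst, mul_one], 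
      (k * s : ℝ) • a, ⟨a, ha, rfl⟩, (k * t : ℝ) • b, ⟨b, hb, rfl⟩, ?_⟩
    simp [smul_smul]
  · rintro ⟨r, s, hr, hs, hrs, _, ⟨a, ha, rfl⟩, _, ⟨b, hb, rfl⟩, rfl⟩
    rcases Nat.eq_zero_or_pos k with rfl | hk
    · have : r = 0 := by push_cast at hrs; linarith
      have : s = 0 := by push_cast at hrs; linarith
      subst_vars
      refine ⟨a, ?_, by simp [*]⟩
      exact mem_convexJoin.2 ⟨a, ha, b, hb, left_mem_segment _ _ _⟩
    · have hk' : (0 : ℝ) < k := by exact_mod_cast hk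
      refine ⟨(r / k) • a + (s / k) • b, mem_convexJoin.2 ⟨a, ha, b, hb, r / k, s / k,
        by positivity, by positivity, by rw [← add_div, hrs, div_self hk'.ne'], rfl⟩, ?_⟩
      simp only [smul_add, smul_smul]
      rw [mul_div_cancel₀ _ hk'.ne', mul_div_cancel₀ _ hk'.ne']

lemma count {α β : Type*} [DecidableEq (α × β)] (A : ℕ → Finset α) (B : ℕ → Finset β) (hA : Monotone A)
    (hB : Monotone B) (k : ℕ) :
    (((Finset.range (k + 1)).biUnion fun i => A i ×ˢ B (k - i)).card : ℤ) =
      (∑ i ∈ Finset.range (k + 1), ((A i).card : ℤ) * ((B (k - i)).card : ℤ)) -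
        ∑ i ∈ Finset.range k, ((A i).card : ℤ) * ((B (k - 1 - i)).card : ℤ) := by
  let B' : ℕ → Finset β := fun j => if j = 0 then ∅ else B (j - 1)
  have hB' : ∀ j, B' j ⊆ B j := by
    intro j
    simp only [B']
    split_ifs
    · simp
    · exact hB (Nat.sub_le _ _)
  have e : ((Finset.range (k + 1)).biUnion fun i => A i ×ˢ B (k - i)) =
      ((Finset.range (k + 1)).biUnion fun i => A i ×ˢ (B (k - i) \ B' (k - i))) := by
    ext ⟨p, q⟩
    simp only [Finset.mem_biUnion, Finset.mem_range, Finset.mem_product, Finset.mem_sdiff]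
    constructor
    · rintro ⟨i, hi, hp, hq⟩
      have hex : ∃ j, q ∈ B j := ⟨_, hq⟩
      have hle : Nat.find hex ≤ k - i := Nat.find_min' hex hq
      refine ⟨k - Nat.find hex, by omega, hA (by omega) hp, ?_⟩
      have : k - (k - Nat.find hex) = Nat.find hex := by omega
      rw [this]
      refine ⟨Nat.find_spec hex, ?_⟩
      simp only [B']
      split_ifs with h
      · simp
      · exact Nat.find_min hex (by omega)
    · rintro ⟨i, hi, hp, hq, _⟩
      exact ⟨i, hi, hp, hq⟩
  rw [e, Finset.card_biUnion]
  · have h1 : ∀ i ∈ Finset.range (k + 1), ((A i ×ˢ (B (k - i) \ B' (k - i))).card : ℤ) =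
        (A i).card * (B (k - i)).card - (A i).card * (B' (k - i)).card := by
      intro i _
      rw [Finset.card_product, Nat.cast_mul, Finset.card_sdiff_of_subset (hB' _),
        Nat.cast_sub (Finset.card_le_card (hB' _)), mul_sub]
    push_cast
    rw [Finset.sum_congr rfl h1, Finset.sum_sub_distrib]
    congr 1
    rw [Finset.sum_range_succ]
    simp only [Nat.sub_self, B', if_true, Finset.card_empty, Nat.cast_zero, mul_zero, add_zero]
    refine Finset.sum_congr rfl fun i hi => ?_
    rw [Finset.mem_range] at hi
    rw [if_neg (by omega), Nat.sub_right_comm]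
  · have key : ∀ i j, i < j → j < k + 1 → Disjoint (A i ×ˢ (B (k - i) \ B' (k - i)))
        (A j ×ˢ (B (k - j) \ B' (k - j))) := by
      intro i j hij hj
      rw [Finset.disjoint_left]
      rintro ⟨p, q⟩ h1 h2
      simp only [Finset.mem_product, Finset.mem_sdiff] at h1 h2
      apply h1.2.2
      simp only [B']
      rw [if_neg (by omega)]
      exact hB (by omega) h2.2.1
    intro i hi j hj hij
    simp only [Finset.coe_range, Set.mem_Iio, Finset.mem_range] at hi hj
    rcases lt_or_gt_of_ne hij with h | h
    · exact key i j h hj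
    · exact (key j i h hi).symm

/-- Braun's theorem. -/
theorem braun_theorem {n : ℕ} (hn : 1 ≤ n) (P Q : Set (Fin n → ℝ))
    (hP : IsLatPolytope P) (hQ : IsLatPolytope Q) (hPrefl : IsReflexive P)
    (hQ0 : (0 : Fin n → ℝ) ∈ intrinsicInterior ℝ Q) (hfree : IsFreeSum P Q) :
    ∀ k : ℕ,
      (ehr (convexHull ℝ (P ∪ Q)) k : ℤ) =
        (∑ i ∈ Finset.range (k + 1), (ehr P i : ℤ) * (ehr Q (k - i) : ℤ)) -
          ∑ i ∈ Finset.range k, (ehr P i : ℤ) * (ehr Q (k - 1 - i) : ℤ) := by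
  have hP0 := hfree.1
  have hQ0' := hfree.2.1
  have hcP := cvx hP
  have hcQ := cvx hQ
  intro k
  have hfP : ∀ i : ℕ, (latt ((i : ℝ) • P)).Finite := fun i =>
    latt_finite ((cpt hP).smul (i : ℝ)).isBounded
  have hfQ : ∀ i : ℕ, (latt ((i : ℝ) • Q)).Finite := fun i =>
    latt_finite ((cpt hQ).smul (i : ℝ)).isBounded
  let A : ℕ → Finset (Fin n → ℝ) := fun i => (hfP i).toFinset
  let B : ℕ → Finset (Fin n → ℝ) := fun i => (hfQ i).toFinset
  have mA : ∀ i x, x ∈ A i ↔ x ∈ (i : ℝ) • P ∧ IsLat x := fun i x => by simp [A, latt]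
  have mB : ∀ i x, x ∈ B i ↔ x ∈ (i : ℝ) • Q ∧ IsLat x := fun i x => by simp [B, latt]
  have hA : Monotone A := fun i j hij x hx => by
    rw [mA] at hx ⊢
    exact ⟨smul_mono hcP hP0 (by positivity) (by exact_mod_cast hij) hx.1, hx.2⟩
  have hB : Monotone B := fun i j hij x hx => by
    rw [mB] at hx ⊢
    exact ⟨smul_mono hcQ hQ0' (by positivity) (by exact_mod_cast hij) hx.1, hx.2⟩
  have eA : ∀ i, ehr P i = (A i).card := fun i => by
    rw [ehr_eq hP0, Set.ncard_eq_toFinset_card _ (hfP i)]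
  have eB : ∀ i, ehr Q i = (B i).card := fun i => by
    rw [ehr_eq hQ0', Set.ncard_eq_toFinset_card _ (hfQ i)]
  simp only [eA, eB]
  rw [← count A B hA hB k, ehr_eq (subset_convexHull ℝ _ (Or.inl hP0))]
  set D := (Finset.range (k + 1)).biUnion fun i => A i ×ˢ B (k - i) with hD
  have mD : ∀ q, q ∈ D ↔ ∃ i, i < k + 1 ∧ q.1 ∈ A i ∧ q.2 ∈ B (k - i) := by
    intro q; simp [hD]
  have himg : latt ((k : ℝ) • convexHull ℝ (P ∪ Q)) =
      (fun q : (Fin n → ℝ) × (Fin n → ℝ) => q.1 + q.2) '' (D : Set _) := by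
    ext m
    constructor
    · rintro ⟨hm, hml⟩
      obtain ⟨r, s, hr, hs, hrs, x, hx, y, hy, rfl⟩ := (mem_sum hcP hcQ hP0 hQ0' k m).1 hm
      have hxs := smul_sub_span hx
      have hys := smul_sub_span hy
      obtain ⟨⟨p, q⟩, ⟨⟨hp, hpl⟩, ⟨hq, hql⟩, hpq⟩, -⟩ := hfree.2.2 (x + y)
        (Submodule.add_mem _ (Submodule.span_mono Set.subset_union_left hxs)
          (Submodule.span_mono Set.subset_union_right hys)) hml
      simp only at hp hpl hq hql hpq
      have e1 : x - p = q - y := by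
        rw [sub_eq_sub_iff_add_eq_add, hpq, add_comm]
      have e2 : x - p = 0 := span_disj hP hQ hfree (Submodule.sub_mem _ hxs hp)
        (e1 ▸ Submodule.sub_mem _ hq hys)
      have e3 : x = p := sub_eq_zero.1 e2
      have e4 : y = q := by rw [e2] at e1; exact (sub_eq_zero.1 e1.symm).symm
      subst e3 e4
      have hfl : ⌊r⌋₊ ≤ k := Nat.floor_le_of_le (by linarith)
      refine ⟨(x, y), ?_, rfl⟩
      rw [Finset.mem_coe, mD]
      refine ⟨⌊r⌋₊, by omega, (mA _ _).2 ⟨integrality hPrefl hr hx hpl, hpl⟩,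
        (mB _ _).2 ⟨smul_mono hcQ hQ0' hs ?_ hy, hql⟩⟩
      rw [Nat.cast_sub hfl]
      have := Nat.floor_le hr
      linarith
    · rintro ⟨⟨p, q⟩, hpq, rfl⟩
      rw [Finset.mem_coe, mD] at hpq
      obtain ⟨i, hi, hp, hq⟩ := hpq
      rw [mA] at hp
      rw [mB] at hq
      refine ⟨(mem_sum hcP hcQ hP0 hQ0' k _).2 ⟨i, (k - i : ℕ), by positivity, by positivity, ?_,
        p, hp.1, q, hq.1, rfl⟩, lat_add hp.2 hq.2⟩
      rw [← Nat.cast_add]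
      congr 1
      omega
  rw [himg, Set.InjOn.ncard_image, Set.ncard_coe_finset]
  rintro ⟨p, q⟩ h1 ⟨p', q'⟩ h2 h
  simp only at h
  rw [Finset.mem_coe, mD] at h1 h2
  obtain ⟨i, -, hp, hq⟩ := h1
  obtain ⟨j, -, hp', hq'⟩ := h2
  rw [mA] at hp hp'
  rw [mB] at hq hq'
  have e1 : p - p' = q' - q := by
    rw [sub_eq_sub_iff_add_eq_add, h, add_comm]
  have e2 : p - p' = 0 := span_disj hP hQ hfree
    (Submodule.sub_mem _ (smul_sub_span hp.1) (smul_sub_span hp'.1))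
    (e1 ▸ Submodule.sub_mem _ (smul_sub_span hq'.1) (smul_sub_span hq.1))
  rw [e2] at e1
  rw [sub_eq_zero.1 e2, sub_eq_zero.1 e1.symm]

end ArxivFreeSum
end
end

section
/- Let P ⊂ ℝ^n be a rational polytope with 0 ∈ P. Then the polar dual P^∨ is a lattice polyhedron if and only if llenv(cone P) = (lenv(cone P))_ℤ. -/
open Set Pointwise
open scoped Classical

noncomputable section

namespace ArxivFreeSum

variable {n : ℕ}

lemma act_span_of_ext {W ι : Type*} [AddCommGroup W] [Module ℝ W] [Fintype ι] (u : ι → W)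
    (φ : Module.Dual ℝ W)
    (h : φ ∈ Set.extremePoints ℝ {φ : Module.Dual ℝ W | ∀ i, φ (u i) ≤ 1}) :
    Submodule.span ℝ (u '' {i | φ (u i) = 1}) = ⊤ := by
  by_contra hne
  obtain ⟨ψ, hψ0, hψ⟩ := Submodule.exists_le_ker_of_lt_top _ (lt_top_iff_ne_top.2 hne)
  have hψ' : ∀ i, φ (u i) = 1 → ψ (u i) = 0 := fun i hi =>
    hψ (Submodule.subset_span ⟨i, hi, rfl⟩)
  have hD : ∀ i, φ (u i) ≤ 1 := h.1
  have hev : ∀ᶠ e : ℝ in nhdsWithin 0 (Set.Ioi 0), ∀ i, e * |ψ (u i)| ≤ 1 - φ (u i) := by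
    rw [Filter.eventually_all]
    intro i
    by_cases hi : φ (u i) = 1
    · simp [hψ' i hi, hi]
    · have hlt : φ (u i) < 1 := lt_of_le_of_ne (hD i) hi
      have hc : Filter.Tendsto (fun e : ℝ => e * |ψ (u i)|) (nhdsWithin 0 (Set.Ioi 0)) (nhds 0) := by
        have : Continuous (fun e : ℝ => e * |ψ (u i)|) := by fun_prop
        have := this.tendsto 0
        simp only [zero_mul] at this
        exact this.mono_left nhdsWithin_le_nhds
      exact (hc.eventually (gt_mem_nhds (sub_pos.2 hlt))).mono fun e he => le_of_lt he
  obtain ⟨e, he, hepos⟩ := (hev.and self_mem_nhdsWithin).exists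
  have hepos : 0 < e := hepos
  rw [mem_extremePoints] at h
  have := (h.2 (φ + e • ψ) (fun i => by
    have := he i
    have h2 := mul_le_mul_of_nonneg_left (le_abs_self (ψ (u i))) hepos.le
    simp only [LinearMap.add_apply, LinearMap.smul_apply, smul_eq_mul]; linarith)
    (φ - e • ψ) (fun i => by
    have := he i
    have h2 := mul_le_mul_of_nonneg_left (neg_abs_le (ψ (u i))) hepos.le
    simp only [LinearMap.sub_apply, LinearMap.smul_apply, smul_eq_mul]; linarith)
    ⟨1/2, 1/2, by norm_num, by norm_num, by norm_num, by
      ext w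
      simp only [LinearMap.add_apply, LinearMap.smul_apply, smul_eq_mul, LinearMap.sub_apply]
      ring⟩).1
  have h0 : e • ψ = 0 := by simpa using this
  rcases smul_eq_zero.1 h0 with h | h
  · exact hepos.ne' h
  · exact hψ0 h

lemma ext_of_act_span {W ι : Type*} [AddCommGroup W] [Module ℝ W] (u : ι → W)
    (φ : Module.Dual ℝ W) (hD : ∀ i, φ (u i) ≤ 1)
    (h : Submodule.span ℝ (u '' {i | φ (u i) = 1}) = ⊤) :
    φ ∈ Set.extremePoints ℝ {φ : Module.Dual ℝ W | ∀ i, φ (u i) ≤ 1} := by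
  rw [mem_extremePoints]
  refine ⟨hD, ?_⟩
  rintro a ha b hb ⟨s, t, hs, ht, hst, heq⟩
  have key : ∀ i, φ (u i) = 1 → a (u i) = 1 ∧ b (u i) = 1 := by
    intro i hi
    have h1 : s * a (u i) + t * b (u i) = 1 := by rw [← hi, ← heq]; simp
    have h2 : a (u i) ≤ 1 := ha i
    have h3 : b (u i) ≤ 1 := hb i
    constructor
    · by_contra hne
      have := lt_of_le_of_ne h2 hne
      nlinarith
    · by_contra hne
      have := lt_of_le_of_ne h3 hne
      nlinarith
  constructor
  · apply LinearMap.ext_on h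
    rintro _ ⟨i, hi, rfl⟩
    rw [(key i hi).1, hi]
  · apply LinearMap.ext_on h
    rintro _ ⟨i, hi, rfl⟩
    rw [(key i hi).2, hi]

lemma exists_ext {W ι : Type*} [AddCommGroup W] [Module ℝ W] [Fintype ι] (u : ι → W)
    (hu : Submodule.span ℝ (Set.range u) = ⊤) (x : W) (t : ℝ)
    (hb : ∀ φ : Module.Dual ℝ W, (∀ i, φ (u i) ≤ 1) → φ x ≤ t) :
    ∀ (N : ℕ) (φ : Module.Dual ℝ W), (∀ i, φ (u i) ≤ 1) → {i | φ (u i) ≠ 1}.ncard = N →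
    ∃ φ' ∈ Set.extremePoints ℝ {φ : Module.Dual ℝ W | ∀ i, φ (u i) ≤ 1}, φ x ≤ φ' x := by
  intro N
  induction N using Nat.strong_induction_on with
  | _ N ih =>
  intro φ hD hN
  by_cases hs : Submodule.span ℝ (u '' {i | φ (u i) = 1}) = ⊤
  · exact ⟨φ, ext_of_act_span u φ hD hs, le_rfl⟩
  obtain ⟨ψ, hψ, hψx, i0, hi0⟩ : ∃ ψ : Module.Dual ℝ W, (∀ i, φ (u i) = 1 → ψ (u i) = 0) ∧
      0 ≤ ψ x ∧ ∃ i, 0 < ψ (u i) := by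
    obtain ⟨ψ, hψ0, hψ⟩ := Submodule.exists_le_ker_of_lt_top _ (lt_top_iff_ne_top.2 hs)
    have hψ' : ∀ i, φ (u i) = 1 → ψ (u i) = 0 := fun i hi =>
      hψ (Submodule.subset_span ⟨i, hi, rfl⟩)
    have pos : ∀ ψ : Module.Dual ℝ W, 0 < ψ x → ∃ i, 0 < ψ (u i) := by
      intro ψ hp
      by_contra! hneg
      set s := (t + 1 - φ x) / ψ x with hsdef
      have hφt := hb φ hD
      have hspos : 0 ≤ s := div_nonneg (by linarith) hp.le
      have := hb (φ + s • ψ) (fun i => by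
        have := mul_nonpos_of_nonneg_of_nonpos hspos (hneg i)
        have := hD i
        simp only [LinearMap.add_apply, LinearMap.smul_apply, smul_eq_mul]; linarith)
      have h2 : s * ψ x = t + 1 - φ x := div_mul_cancel₀ _ hp.ne'
      simp only [LinearMap.add_apply, LinearMap.smul_apply, smul_eq_mul] at this
      linarith
    rcases lt_trichotomy (ψ x) 0 with h | h | h
    · refine ⟨-ψ, fun i hi => by simp [hψ' i hi], by simpa using h.le, pos _ (by simpa using h)⟩
    · have : ∃ i, ψ (u i) ≠ 0 := by
        by_contra! hz
        apply hψ0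
        apply LinearMap.ext_on hu
        rintro _ ⟨i, rfl⟩
        simp [hz i]
      obtain ⟨i, hi⟩ := this
      rcases lt_or_gt_of_ne hi with hi | hi
      · exact ⟨-ψ, fun i hi => by simp [hψ' i hi], by simp [h], i, by simpa using hi⟩
      · exact ⟨ψ, hψ', h.ge, i, hi⟩
    · exact ⟨ψ, hψ', h.le, pos _ h⟩
  classical
  obtain ⟨j, hj, hmin⟩ := Finset.exists_min_image (Finset.univ.filter fun i => 0 < ψ (u i))
    (fun i => (1 - φ (u i)) / ψ (u i)) ⟨i0, by simpa using hi0⟩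
  have hj : 0 < ψ (u j) := by simpa using hj
  set s := (1 - φ (u j)) / ψ (u j) with hsdef
  have hs0 : 0 ≤ s := div_nonneg (by linarith [hD j]) hj.le
  have hsj : s * ψ (u j) = 1 - φ (u j) := div_mul_cancel₀ _ hj.ne'
  have hD' : ∀ i, (φ + s • ψ) (u i) ≤ 1 := by
    intro i
    simp only [LinearMap.add_apply, LinearMap.smul_apply, smul_eq_mul]
    rcases le_or_gt (ψ (u i)) 0 with h | h
    · have := mul_nonpos_of_nonneg_of_nonpos hs0 h
      linarith [hD i]
    · have := hmin i (by simpa using h)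
      rw [le_div_iff₀ h] at this
      linarith
  obtain ⟨φ', h1, h2⟩ := ih _ (by
    rw [← hN]
    apply Set.ncard_lt_ncard _ (Set.toFinite _)
    refine ⟨fun i hi hi' => hi (by simp [hi', hψ i hi']), fun hsub => ?_⟩
    have : φ (u j) ≠ 1 := fun h => hj.ne' (hψ j h)
    have := hsub this
    apply this
    simp only [LinearMap.add_apply, LinearMap.smul_apply, smul_eq_mul, hsj]
    ring) (φ + s • ψ) hD' rfl
  refine ⟨φ', h1, le_trans ?_ h2⟩
  simp only [LinearMap.add_apply, LinearMap.smul_apply, smul_eq_mul]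
  have := mul_nonneg hs0 hψx
  linarith

/-- The set of `t ≥ 0` with `x ∈ t P`. -/
def Gset (P : Set (Fin n → ℝ)) (x : Fin n → ℝ) : Set ℝ := {t | 0 ≤ t ∧ ∃ a ∈ P, x = t • a}

lemma smul_emb (l : ℝ) (a : Fin n → ℝ) : l • emb a = Fin.snoc (l • a) l := by
  funext i
  refine Fin.lastCases ?_ (fun j => ?_) i <;> simp [emb]

lemma snoc_mem_cone (P : Set (Fin n → ℝ)) (x : Fin n → ℝ) (t : ℝ) :
    (Fin.snoc x t : Fin (n + 1) → ℝ) ∈ cone P ↔ t ∈ Gset P x := by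
  constructor
  · rintro ⟨l, a, ha, hl, h⟩
    rw [smul_emb, Fin.snoc_inj] at h
    obtain ⟨rfl, rfl⟩ := h
    exact ⟨hl, a, ha, rfl⟩
  · rintro ⟨hl, a, ha, rfl⟩
    exact ⟨t, a, ha, hl, (smul_emb t a).symm⟩

lemma snoc_sub (x : Fin n → ℝ) (s l : ℝ) :
    (Fin.snoc x s : Fin (n + 1) → ℝ) - l • eLast n = Fin.snoc x (s - l) := by
  funext i
  refine Fin.lastCases ?_ (fun j => ?_) i
  · simp [eLast]
  · have : Fin.castSucc j ≠ Fin.last n := (Fin.castSucc_lt_last j).ne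
    simp [eLast, this]

lemma gset_bdd (P : Set (Fin n → ℝ)) (x : Fin n → ℝ) : BddBelow (Gset P x) :=
  ⟨0, fun _ h => h.1⟩

lemma gset_up (P : Set (Fin n → ℝ)) (hc : Convex ℝ P) (h0 : (0 : Fin n → ℝ) ∈ P)
    (x : Fin n → ℝ) {s t : ℝ} (hs : s ∈ Gset P x) (hst : s ≤ t) : t ∈ Gset P x := by
  obtain ⟨h, a, ha, rfl⟩ := hs
  rcases (h.trans hst).eq_or_lt with ht | ht
  · obtain rfl : s = t := by linarith
    exact ⟨h, a, ha, rfl⟩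
  · refine ⟨ht.le, (s / t) • a, hc.smul_mem_of_zero_mem h0 ha
      ⟨div_nonneg h ht.le, (div_le_one ht).2 hst⟩, ?_⟩
    rw [smul_smul, mul_div_cancel₀ _ ht.ne']

lemma eps_snoc (P : Set (Fin n → ℝ)) (x : Fin n → ℝ) (s : ℝ) (hs : s ∈ Gset P x) :
    eps P (Fin.snoc x s) = Fin.snoc x (sInf (Gset P x)) := by
  unfold eps
  simp only [snoc_sub, snoc_mem_cone]
  have hg : IsGLB (Gset P x) (sInf (Gset P x)) := isGLB_csInf ⟨s, hs⟩ (gset_bdd P x)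
  have : IsLUB {l : ℝ | s - l ∈ Gset P x} (s - sInf (Gset P x)) := by
    constructor
    · intro l hl
      have := hg.1 hl
      linarith
    · intro b hb
      have : s - b ≤ sInf (Gset P x) := hg.2 (fun t ht => by
        have : s - t ≤ b := hb (by simpa using ht)
        linarith)
      linarith
  rw [this.csSup_eq ⟨0, by simpa using hs⟩]
  congr 1
  ring

lemma isLat_snoc (x : Fin n → ℝ) (t : ℝ) :
    IsLat (Fin.snoc x t : Fin (n + 1) → ℝ) ↔ IsLat x ∧ ∃ z : ℤ, t = z := by
  constructor
  · intro h
    refine ⟨fun i => ?_, ?_⟩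
    · simpa using h i.castSucc
    · simpa using h (Fin.last n)
  · rintro ⟨h, h2⟩ i
    refine Fin.lastCases ?_ (fun j => ?_) i
    · simpa using h2
    · simpa using h j

lemma llenv_iff (P : Set (Fin n → ℝ)) (hc : Convex ℝ P) (h0 : (0 : Fin n → ℝ) ∈ P) :
    llenv P = latt (lenv P) ↔
      ∀ x, IsLat x → (Gset P x).Nonempty → ∃ z : ℤ, sInf (Gset P x) = z := by
  constructor
  · rintro h x hx ⟨s, hs⟩
    have h1 : (Fin.snoc x (sInf (Gset P x)) : Fin (n + 1) → ℝ) ∈ llenv P := by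
      have h2 := gset_up P hc h0 x hs (Int.le_ceil s)
      refine ⟨Fin.snoc x (⌈s⌉ : ℝ), ⟨(snoc_mem_cone P x _).2 h2,
        (isLat_snoc _ _).2 ⟨hx, _, rfl⟩⟩, eps_snoc P x _ h2⟩
    rw [h] at h1
    exact ((isLat_snoc _ _).1 h1.2).2
  · intro h
    ext y
    constructor
    · rintro ⟨w, ⟨hw, hl⟩, rfl⟩
      refine ⟨⟨w, hw, rfl⟩, ?_⟩
      rw [← Fin.snoc_init_self w] at hw hl ⊢
      have hw' := (snoc_mem_cone P _ _).1 hw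
      have hl' := (isLat_snoc _ _).1 hl
      rw [eps_snoc P _ _ hw', isLat_snoc]
      exact ⟨hl'.1, h _ hl'.1 ⟨_, hw'⟩⟩
    · rintro ⟨⟨w, hw, rfl⟩, hl⟩
      rw [← Fin.snoc_init_self w] at hw hl ⊢
      have hw' := (snoc_mem_cone P _ _).1 hw
      rw [eps_snoc P _ _ hw', isLat_snoc] at hl
      have h2 := gset_up P hc h0 _ hw' (Int.le_ceil _)
      rw [eps_snoc P _ _ hw']
      exact ⟨Fin.snoc _ _, ⟨(snoc_mem_cone P _ _).2 h2,
        (isLat_snoc _ _).2 ⟨hl.1, _, rfl⟩⟩, eps_snoc P _ _ h2⟩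

lemma rat_mult (w : Fin n → ℝ) (hw : ∀ i, ∃ q : ℚ, w i = q) :
    ∃ N : ℕ, 0 < N ∧ IsLat ((N : ℝ) • w) := by
  choose q hq using hw
  refine ⟨∏ i, (q i).den, Finset.prod_pos fun i _ => (q i).den_pos, fun i => ?_⟩
  obtain ⟨k, hk⟩ := Finset.dvd_prod_of_mem (fun i => (q i).den) (Finset.mem_univ i)
  refine ⟨(q i).num * k, ?_⟩
  have h1 : ((q i).den : ℝ) * (q i : ℝ) = (q i).num := by
    exact_mod_cast Rat.den_mul_eq_num (q i)
  simp only [Pi.smul_apply, smul_eq_mul, hq, hk]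
  push_cast
  rw [← h1]
  ring

lemma IsLat.add {x y : Fin n → ℝ} (hx : IsLat x) (hy : IsLat y) : IsLat (x + y) := by
  intro i
  obtain ⟨a, ha⟩ := hx i
  obtain ⟨b, hb⟩ := hy i
  exact ⟨a + b, by simp [ha, hb]⟩

lemma IsLat.nsmul {x : Fin n → ℝ} (hx : IsLat x) (k : ℕ) : IsLat ((k : ℝ) • x) := by
  intro i
  obtain ⟨a, ha⟩ := hx i
  exact ⟨k * a, by simp [ha]⟩

lemma dual_le (P : Set (Fin n → ℝ)) (φ : Module.Dual ℝ (Submodule.span ℝ P))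
    (hφ : φ ∈ dualSet P) (x : Submodule.span ℝ P) {t : ℝ} (ht : t ∈ Gset P x) : φ x ≤ t := by
  obtain ⟨h, a, ha, hx⟩ := ht
  have : x = t • (⟨a, Submodule.subset_span ha⟩ : Submodule.span ℝ P) := Subtype.ext hx
  rw [this, map_smul, smul_eq_mul]
  exact mul_le_of_le_one_right h (hφ ⟨a, _⟩ ha)

lemma gset_of_sum {ι : Type*} (P : Set (Fin n → ℝ)) (hc : Convex ℝ P)
    (h0 : (0 : Fin n → ℝ) ∈ P) (S : Finset ι) (v : ι → Fin n → ℝ) (hv : ∀ i ∈ S, v i ∈ P)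
    (c : ι → ℝ) (hcn : ∀ i ∈ S, 0 ≤ c i) :
    ∑ i ∈ S, c i ∈ Gset P (∑ i ∈ S, c i • v i) := by
  rcases (Finset.sum_nonneg hcn).eq_or_lt with h | h
  · have hz : ∀ i ∈ S, c i = 0 := (Finset.sum_eq_zero_iff_of_nonneg hcn).1 h.symm
    refine ⟨h.le, 0, h0, ?_⟩
    rw [smul_zero]
    exact Finset.sum_eq_zero fun i hi => by rw [hz i hi, zero_smul]
  · refine ⟨h.le, S.centerMass c v, hc.centerMass_mem hcn h hv, ?_⟩
    rw [Finset.centerMass, smul_smul, mul_inv_cancel₀ h.ne', one_smul]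

/-- Proposition 3.2 (lattice polyhedral dual ↔ lower lattice envelope
consists of lattice points). -/
theorem dual_lattice_iff_llenv {n : ℕ} (hn : 1 ≤ n) (P : Set (Fin n → ℝ))
    (hP : IsRatPolytope P) (hP0 : (0 : Fin n → ℝ) ∈ P) :
    DualIsLatticePolyhedron P ↔ llenv P = latt (lenv P) := by
  obtain ⟨V, hVrat, rfl⟩ := hP
  set P := convexHull ℝ (V : Set (Fin n → ℝ)) with hPdef
  have hc : Convex ℝ P := convex_convexHull ℝ _
  have hVP : ∀ v ∈ V, v ∈ P := fun v hv => subset_convexHull ℝ _ hv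
  rw [llenv_iff P hc hP0]
  set u : V → Submodule.span ℝ P := fun v => ⟨v.1, Submodule.subset_span (hVP v.1 v.2)⟩ with hudef
  have hdual : dualSet P = {φ : Module.Dual ℝ (Submodule.span ℝ P) | ∀ i, φ (u i) ≤ 1} := by
    ext φ
    constructor
    · intro h v
      exact h (u v) (hVP v.1 v.2)
    · intro h
      have hcv : Convex ℝ ((Submodule.span ℝ P).subtype '' {a | φ a ≤ 1}) :=
        (convex_halfSpace_le φ.isLinear 1).linear_image _
      have hsub : P ⊆ (Submodule.span ℝ P).subtype '' {a | φ a ≤ 1} :=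
        convexHull_min (fun v hv => ⟨u ⟨v, hv⟩, h _, rfl⟩) hcv
      intro a ha
      obtain ⟨b, hb, hab⟩ := hsub ha
      obtain rfl : b = a := Subtype.ext hab
      exact hb
  have hu : Submodule.span ℝ (Set.range u) = ⊤ := by
    have himg : (Submodule.span ℝ P).subtype '' (Set.range u) = V := by
      ext x
      constructor
      · rintro ⟨_, ⟨v, rfl⟩, rfl⟩
        exact v.2
      · intro hv
        exact ⟨_, ⟨⟨x, hv⟩, rfl⟩, rfl⟩
    apply Submodule.map_injective_of_injective (Submodule.span ℝ P).injective_subtype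
    rw [Submodule.map_span, himg, Submodule.map_subtype_top]
    apply le_antisymm
    · exact Submodule.span_mono hVP
    · exact Submodule.span_le.2 (convexHull_min Submodule.subset_span (Submodule.convex _))
  constructor
  · intro hlat x hx hne
    by_contra hni
    set g := sInf (Gset P x) with hg
    have hg0 : 0 ≤ g := le_csInf hne fun t ht => ht.1
    have hfl : (⌊g⌋ : ℝ) < g := lt_of_le_of_ne (Int.floor_le g) fun h => hni ⟨_, h.symm⟩
    obtain ⟨t, ht1, ht2⟩ := exists_between hfl
    have hf0 : (0 : ℝ) ≤ (⌊g⌋ : ℝ) := by exact_mod_cast Int.floor_nonneg.2 hg0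
    have ht0 : 0 < t := by linarith
    have htn : t⁻¹ • x ∉ P := by
      intro h
      have : g ≤ t := csInf_le (gset_bdd P x) ⟨ht0.le, _, h, by
        rw [smul_smul, mul_inv_cancel₀ ht0.ne', one_smul]⟩
      linarith
    have hcl : IsClosed P := (V.finite_toSet.isCompact_convexHull ℝ).isClosed
    obtain ⟨f, b, hfb, hbf⟩ := geometric_hahn_banach_closed_point hc hcl htn
    have hb0 : 0 < b := by simpa using hfb 0 hP0
    have hxs : x ∈ Submodule.span ℝ P := by
      obtain ⟨s, -, a, ha, rfl⟩ := hne
      exact Submodule.smul_mem _ _ (Submodule.subset_span ha)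
    set φ : Module.Dual ℝ (Submodule.span ℝ P) :=
      b⁻¹ • (f.toLinearMap ∘ₗ (Submodule.span ℝ P).subtype) with hφ
    have hφa : ∀ a, φ a = b⁻¹ * f a := fun a => by simp [hφ]
    have hφD : ∀ i, φ (u i) ≤ 1 := by
      intro i
      rw [hφa, inv_mul_le_iff₀ hb0, mul_one]
      exact (hfb _ (hVP i.1 i.2)).le
    have hφx : t < φ ⟨x, hxs⟩ := by
      rw [hφa, lt_inv_mul_iff₀ hb0]
      have h2 : b < t⁻¹ * f x := by simpa using hbf
      rw [lt_inv_mul_iff₀ ht0] at h2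
      linarith
    have hbound : ∀ φ : Module.Dual ℝ (Submodule.span ℝ P), (∀ i, φ (u i) ≤ 1) →
        φ ⟨x, hxs⟩ ≤ g := by
      intro φ h
      have h : φ ∈ dualSet P := by rw [hdual]; exact h
      exact le_csInf hne fun s hs => dual_le P φ h ⟨x, hxs⟩ hs
    obtain ⟨φ', h1, h2⟩ := exists_ext u hu ⟨x, hxs⟩ g hbound _ φ hφD rfl
    obtain ⟨z, hz⟩ := hlat φ' (by rw [hdual]; exact h1) ⟨x, hxs⟩ hx
    have h3 := hbound φ' h1.1
    rw [hz] at h2 h3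
    have h4 : z ≤ ⌊g⌋ := Int.le_floor.2 h3
    have h5 : (z : ℝ) ≤ (⌊g⌋ : ℝ) := by exact_mod_cast h4
    linarith
  · intro hint φ hφ a ha
    have hφ' := hφ
    rw [hdual] at hφ'
    have hsp := act_span_of_ext u φ hφ'
    set S : Finset V := Finset.univ.filter fun i => φ (u i) = 1 with hS
    have hSmem : ∀ i ∈ S, φ (u i) = 1 := fun i hi => by simpa [hS] using hi
    -- values of `φ` on lattice points of the normal cone are integers
    have key : ∀ c : V → ℝ, (∀ i ∈ S, 0 ≤ c i) → ∀ x : Submodule.span ℝ P,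
        x = ∑ i ∈ S, c i • u i → IsLat (x : Fin n → ℝ) → ∃ z : ℤ, φ x = z := by
      intro c hcn x hx hxl
      have hφx : φ x = ∑ i ∈ S, c i := by
        rw [hx, map_sum]
        refine Finset.sum_congr rfl fun i hi => ?_
        rw [map_smul, hSmem i hi, smul_eq_mul, mul_one]
      have hmem : φ x ∈ Gset P (x : Fin n → ℝ) := by
        have := gset_of_sum P hc hP0 S (fun i => (i : Fin n → ℝ)) (fun i _ => hVP i.1 i.2) c hcn
        rw [hφx, hx]
        simpa [hudef] using this
      obtain ⟨z, hz⟩ := hint x hxl ⟨_, hmem⟩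
      refine ⟨z, ?_⟩
      rw [← hz]
      exact le_antisymm (le_csInf ⟨_, hmem⟩ fun s hs => dual_le P φ hφ.1 x hs)
        (csInf_le (gset_bdd _ _) hmem)
    obtain ⟨c, hcsum⟩ : ∃ c : V → ℝ, ∑ i ∈ S, c i • u i = a := by
      have hmem : a ∈ Submodule.span ℝ (u '' (S : Set V)) := by
        have : (S : Set V) = {i | φ (u i) = 1} := by ext i; simp [hS]
        rw [this, hsp]
        trivial
      obtain ⟨c, h⟩ := (Submodule.mem_span_image_finset_iff_exists_fun ℝ).1 hmem
      refine ⟨fun i => if hi : i ∈ S then c ⟨i, hi⟩ else 0, ?_⟩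
      rw [← h, ← Finset.sum_coe_sort S]
      exact Finset.sum_congr rfl fun i _ => by simp
    set w : Submodule.span ℝ P := ∑ i ∈ S, u i with hw
    obtain ⟨N, hN, hNl⟩ := rat_mult (w : Fin n → ℝ) (by
      intro j
      have : ∀ i : V, ∃ q : ℚ, (i : Fin n → ℝ) j = q := fun i => hVrat i.1 i.2 j
      choose q hq using this
      refine ⟨∑ i ∈ S, q i, ?_⟩
      simp [hw, hudef, hq])
    obtain ⟨k, hk⟩ := exists_nat_ge (∑ i ∈ S, |c i|)
    have hck : ∀ i ∈ S, 0 ≤ c i + (k : ℝ) * N := by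
      intro i hi
      have h1 : |c i| ≤ ∑ i ∈ S, |c i| := Finset.single_le_sum (fun i _ => abs_nonneg (c i)) hi
      have h2 : (1 : ℝ) ≤ N := by exact_mod_cast hN
      have h3 : (k : ℝ) ≤ k * N := le_mul_of_one_le_right (Nat.cast_nonneg k) h2
      linarith [neg_abs_le (c i)]
    have hkw : IsLat (((k : ℝ) • ((N : ℝ) • w) : Submodule.span ℝ P) : Fin n → ℝ) := by
      simpa using hNl.nsmul k
    obtain ⟨z1, hz1⟩ := key (fun _ => (k : ℝ) * N) (fun i _ => by positivity)
      ((k : ℝ) • ((N : ℝ) • w)) (by rw [smul_smul, hw, Finset.smul_sum]) hkw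
    obtain ⟨z2, hz2⟩ := key (fun i => c i + (k : ℝ) * N) hck
      (a + (k : ℝ) • ((N : ℝ) • w)) (by
        rw [smul_smul, hw, Finset.smul_sum, ← hcsum, ← Finset.sum_add_distrib]
        exact Finset.sum_congr rfl fun i _ => (add_smul _ _ _).symm) (ha.add hkw)
    refine ⟨z2 - z1, ?_⟩
    rw [map_add, hz1] at hz2
    push_cast
    linarith

end ArxivFreeSum
end
end
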